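/- arXiv:1711.02147 — 2 statements merged into one kernel-verified Lean document; each statement's English description precedes it below -/
import Mathlib

section
/- Let H be a finitely generated subgroup of SL(2n,ℤ) containing a transvection t, and let N be the normal closure of {t} in H. If N is absolutely irreducible over ℚ and there exists h ∈ N with tr(h) ≠ tr(h⁻¹), then φ_p(H) = SL(2n,ℤ/pℤ) for all but finitely many primes p; in particular there is a prime p > 3 with φ_p(H) = SL(2n,ℤ/pℤ). -/
open Matrix

/-- `SL n R` : the special linear group of `n × n` matrices over `R`. -/
abbrev SL (n : ℕ) (R : Type*) [CommRing R] := Matrix.SpecialLinearGroup (Fin n) R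

/-- The reduction-mod-`p` homomorphism `φ_p : SL(n,ℤ) → SL(n,ℤ/pℤ)`. -/
def redMod (n p : ℕ) : SL n ℤ →* SL n (ZMod p) :=
  Matrix.SpecialLinearGroup.map (Int.castRingHom (ZMod p))

/-- The rational matrix underlying an element of `SL(n,ℤ)`. -/
def matQ {n : ℕ} (g : SL n ℤ) : Matrix (Fin n) (Fin n) ℚ :=
  (g : Matrix (Fin n) (Fin n) ℤ).map ((↑) : ℤ → ℚ)

/-- A subgroup of `SL(n,ℤ)` is absolutely irreducible over `ℚ` if its elements generate the
full matrix algebra over `ℚ`. -/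
def AbsIrredQ {n : ℕ} (H : Subgroup (SL n ℤ)) : Prop :=
  Algebra.adjoin ℚ (matQ '' (H : Set (SL n ℤ))) = ⊤

/-- A subgroup of `SL(n, ℤ/pℤ)` is absolutely irreducible if its elements generate the
full matrix algebra over `ℤ/pℤ`. -/
def AbsIrredMod {n p : ℕ} (G : Subgroup (SL n (ZMod p))) : Prop :=
  Algebra.adjoin (ZMod p)
    ((fun g : SL n (ZMod p) => (g : Matrix (Fin n) (Fin n) (ZMod p))) '' (G : Set _)) = ⊤

/-- Irreducibility of the natural action of a subgroup of `SL(n,R)` on `R^n`. -/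
def IrreducibleSub (R : Type*) [CommRing R] {n : ℕ} (G : Subgroup (SL n R)) : Prop :=
  ∀ W : Submodule R (Fin n → R),
    (∀ g ∈ G, W.map (Matrix.toLin' (g : Matrix (Fin n) (Fin n) R)) ≤ W) → W = ⊥ ∨ W = ⊤

/-- Imprimitivity: a nontrivial direct-sum decomposition whose summands are permuted by `G`. -/
def ImprimitiveSub (R : Type*) [CommRing R] {n : ℕ} (G : Subgroup (SL n R)) : Prop :=
  ∃ m : ℕ, 2 ≤ m ∧ ∃ W : Fin m → Submodule R (Fin n → R),
    (∀ i, W i ≠ ⊥) ∧ DirectSum.IsInternal W ∧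
    ∀ g ∈ G, ∀ i, ∃ j, (W i).map (Matrix.toLin' (g : Matrix (Fin n) (Fin n) R)) = W j

/-- Primitivity: irreducible and not imprimitive. -/
def PrimitiveSub (R : Type*) [CommRing R] {n : ℕ} (G : Subgroup (SL n R)) : Prop :=
  IrreducibleSub R G ∧ ¬ ImprimitiveSub R G

/-- Monomiality: a direct sum of `n` one-dimensional subspaces permuted by `G`. -/
def MonomialSub (R : Type*) [CommRing R] {n : ℕ} (G : Subgroup (SL n R)) : Prop :=
  ∃ L : Fin n → Submodule R (Fin n → R),
    (∀ i, Module.finrank R (L i) = 1) ∧ DirectSum.IsInternal L ∧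
    ∀ g ∈ G, ∀ i, ∃ j, (L i).map (Matrix.toLin' (g : Matrix (Fin n) (Fin n) R)) = L j

/-- Irreducibility of a subgroup of `SL(n,ℤ)` acting on `ℚ^n`. -/
def IrreducibleQ {n : ℕ} (H : Subgroup (SL n ℤ)) : Prop :=
  ∀ W : Submodule ℚ (Fin n → ℚ),
    (∀ g ∈ H, W.map (Matrix.toLin' (matQ g)) ≤ W) → W = ⊥ ∨ W = ⊤

/-- Imprimitivity of a subgroup of `SL(n,ℤ)` acting on `ℚ^n`. -/
def ImprimitiveQ {n : ℕ} (H : Subgroup (SL n ℤ)) : Prop :=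
  ∃ m : ℕ, 2 ≤ m ∧ ∃ W : Fin m → Submodule ℚ (Fin n → ℚ),
    (∀ i, W i ≠ ⊥) ∧ DirectSum.IsInternal W ∧
    ∀ g ∈ H, ∀ i, ∃ j, (W i).map (Matrix.toLin' (matQ g)) = W j

/-- Primitivity of a subgroup of `SL(n,ℤ)` acting on `ℚ^n`. -/
def PrimitiveQ {n : ℕ} (H : Subgroup (SL n ℤ)) : Prop :=
  IrreducibleQ H ∧ ¬ ImprimitiveQ H

/-- A group is solvable-by-finite if it has a solvable subgroup of finite index. -/
def SolvableByFinite (G : Type*) [Group G] : Prop :=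
  ∃ K : Subgroup G, IsSolvable K ∧ K.FiniteIndex

/-- A subgroup of `SL(n,ℤ)` is an isometry group if it preserves a nondegenerate bilinear
form on `ℚ^n`. -/
def IsometryGroupQ {n : ℕ} (H : Subgroup (SL n ℤ)) : Prop :=
  ∃ Φ : Matrix (Fin n) (Fin n) ℚ, IsUnit Φ ∧ ∀ h ∈ H, matQ h * Φ * (matQ h)ᵀ = Φ

section Helpers

open Module

/-- Abstract properties of the pairs `(a, f)` (with `f a = 0`) such that `1 + a ⊗ f` lies in an
irreducible linear group generated by transvections. -/
structure TSys {K V : Type*} [Field K] [AddCommGroup V] [Module K V]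
    (T : V → Dual K V → Prop) : Prop where
  perp : ∀ {a f}, T a f → f a = 0
  zero : ∀ a, T a 0
  smul : ∀ {a f} (s : K), T a f → T a (s • f)
  swap : ∀ {a f} (s : K), T (s • a) f ↔ T a (s • f)
  addR : ∀ {a f g}, T a f → T a g → T a (f + g)
  addL : ∀ {a b f}, T a f → T b f → T (a + b) f
  conj : ∀ {a f b g}, T a f → T b g → T (a + g a • b) (f - f b • g)
  irr : ∀ W : Submodule K V, (∀ b g, T b g → ∀ w ∈ W, g w • b ∈ W) → W = ⊥ ∨ W = ⊤

namespace TSys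

set_option linter.unusedSectionVars false

variable {K V : Type*} [Field K] [AddCommGroup V] [Module K V] [FiniteDimensional K V]
  {T : V → Dual K V → Prop}

/-- The space of axes with given center. -/
def F (hT : TSys T) (a : V) : Submodule K (Dual K V) where
  carrier := {f | T a f}
  add_mem' := fun h1 h2 => hT.addR h1 h2
  zero_mem' := hT.zero a
  smul_mem' := fun s _ h => hT.smul s h

theorem mem_F (hT : TSys T) {a : V} {f : Dual K V} : f ∈ hT.F a ↔ T a f := Iff.rfl

theorem sub (hT : TSys T) {a : V} {f g : Dual K V} (h1 : T a f) (h2 : T a g) : T a (f - g) :=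
  (hT.F a).sub_mem h1 h2

theorem conj' (hT : TSys T) {a f b g} (s : K) (h1 : T a f) (h2 : T b g) :
    T (a + (s * g a) • b) (f - (s * f b) • g) := by
  have := hT.conj h1 (hT.smul s h2)
  convert this using 2
  · simp
  · rw [smul_smul, mul_comm]

theorem r1 (hT : TSys T) {a f b g} (h1 : T a f) (h2 : T b g) (h : f b = 0) (h' : g a ≠ 0) :
    T b f := by
  have h3 := hT.conj h1 h2
  rw [h, zero_smul, sub_zero] at h3
  have h4 : T (-a) f := by
    have := (hT.swap (a := a) (f := f) (-1)).2 (hT.smul (-1) h1)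
    simpa using this
  have h5 := hT.addL h3 h4
  have h6 : T (g a • b) f := by
    convert h5 using 1; abel
  have h7 := hT.smul (g a)⁻¹ ((hT.swap _).1 h6)
  rwa [smul_smul, inv_mul_cancel₀ h', one_smul] at h7

theorem irrDual (hT : TSys T) (E : Submodule K (Dual K V))
    (h : ∀ b g, T b g → ∀ e ∈ E, e b ≠ 0 → g ∈ E) : E = ⊥ ∨ E = ⊤ := by
  have key := hT.irr E.dualCoannihilator (by
    intro b g hbg w hw
    rw [Submodule.mem_dualCoannihilator] at hw ⊢
    intro e he
    by_cases heb : e b = 0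
    · simp [heb]
    · have := hw g (h b g hbg e he heb)
      simp [this])
  have e2 : E.dualCoannihilator.dualAnnihilator = E := Subspace.dualCoannihilator_dualAnnihilator_eq
  rcases key with h | h
  · right; rw [← e2, h]; simp
  · left; rw [← e2, h]; simp

/-- a center with maximal space of axes -/
def IsMax (hT : TSys T) (a : V) : Prop :=
  a ≠ 0 ∧ ∀ b, b ≠ 0 → finrank K (hT.F b) ≤ finrank K (hT.F a)

theorem exists_max (hT : TSys T) {a : V} (ha : a ≠ 0) :
    ∃ b, hT.IsMax b ∧ finrank K (hT.F a) ≤ finrank K (hT.F b) := by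
  classical
  let P : ℕ → Prop := fun k => ∃ b, b ≠ 0 ∧ finrank K (hT.F b) = k
  have hb : ∀ b, finrank K (hT.F b) ≤ finrank K (Dual K V) := fun b => Submodule.finrank_le _
  have h1 := Nat.findGreatest_spec (P := P) (hb a) ⟨a, ha, rfl⟩
  obtain ⟨b, hb0, hbk⟩ := h1
  refine ⟨b, ⟨hb0, fun c hc => ?_⟩, ?_⟩
  · rw [hbk]; exact Nat.le_findGreatest (hb c) ⟨c, hc, rfl⟩
  · rw [hbk]; exact Nat.le_findGreatest (hb a) ⟨a, ha, rfl⟩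

theorem max_link (hT : TSys T) {a b : V} {g : Dual K V} (ha : hT.IsMax a) (hb : b ≠ 0)
    (hg : T b g) (hga : g a ≠ 0) : ∃ f, T a f ∧ f b ≠ 0 := by
  by_contra! hcon
  have hlt : hT.F a < hT.F b := by
    refine lt_of_le_of_ne (fun f hf => hT.r1 hf hg (hcon f hf) hga) (fun h => ?_)
    have : g ∈ hT.F a := h ▸ hg
    exact hga (hT.perp this)
  exact absurd (ha.2 b hb) (not_le.2 (Submodule.finrank_lt_finrank_of_lt hlt))

theorem finrank_le_inf (hT : TSys T) {a b : V} {f g : Dual K V}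
    (hf : T a f) (hfb : f b ≠ 0) (hg : T b g) (hga : g a ≠ 0) :
    finrank K (hT.F a) ≤ finrank K ↥(hT.F a ⊓ hT.F b) + 1 := by
  have h1 : hT.F a ≤ (hT.F a ⊓ hT.F b) ⊔ Submodule.span K {f} := by
    intro e he
    have h2 : e - (e b / f b) • f ∈ hT.F a ⊓ hT.F b := by
      have h3 : T a (e - (e b / f b) • f) := hT.sub he (hT.smul _ hf)
      refine ⟨h3, hT.r1 h3 hg ?_ hga⟩
      simp [hfb]
    have := Submodule.add_mem_sup h2 (Submodule.smul_mem _ (e b / f b)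
      (Submodule.mem_span_singleton_self (R := K) f))
    simpa using this
  refine (Submodule.finrank_mono h1).trans ((Submodule.finrank_add_le_finrank_add_finrank _ _).trans
    (Nat.add_le_add_left ((finrank_span_le_card ({f} : Set (Dual K V))).trans (by simp)) _))

theorem max_of (hT : TSys T) {a b : V} {g : Dual K V} (ha : hT.IsMax a) (hb : b ≠ 0)
    (hg : T b g) (hga : g a ≠ 0) : hT.IsMax b := by
  obtain ⟨f, hf, hfb⟩ := hT.max_link ha hb hg hga
  have h1 := hT.finrank_le_inf hf hfb hg hga
  have h2 : hT.F a ⊓ hT.F b < hT.F b := by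
    refine lt_of_le_of_ne inf_le_right fun h => ?_
    have : g ∈ hT.F a ⊓ hT.F b := by rw [h]; exact hg
    exact hga (hT.perp this.1)
  have h3 := Submodule.finrank_lt_finrank_of_lt h2
  exact ⟨hb, fun c hc => (ha.2 c hc).trans (by omega)⟩

/-- main step -/
theorem mem_E (hT : TSys T) (hK : ∀ u v : K, ∃ s, s ≠ u ∧ s ≠ v) {a b c : V} {f g h δ : Dual K V}
    (ha : hT.IsMax a) (hb : hT.IsMax b)
    (hf : T a f) (hfb : f b ≠ 0) (hg : T b g) (hga : g a ≠ 0)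
    (hδa : T a δ) (hδb : T b δ) (hδ : δ ≠ 0)
    (hc : c ≠ 0) (hh : T c h) (hha : h a ≠ 0) (hhb : h b ≠ 0) : h ∈ hT.F a ⊔ hT.F b := by
  have hcm := hT.max_of ha hc hh hha
  obtain ⟨fa, hfa, hfac⟩ := hT.max_link ha hc hh hha
  obtain ⟨fb, hfb', hfbc⟩ := hT.max_link hb hc hh hhb
  by_cases h1 : ∃ e, T c e ∧ T a e ∧ e b ≠ 0
  · obtain ⟨e, hec, hea, heb⟩ := h1
    have h2 : T c (h - (h b / e b) • e) := hT.sub hh (hT.smul _ hec)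
    have h3 : T b (h - (h b / e b) • e) := hT.r1 h2 hfb' (by simp [heb]) hfbc
    have := Submodule.add_mem_sup (S := hT.F a) (T := hT.F b) (hT.smul (h b / e b) hea) h3
    simpa using this
  by_cases h1' : ∃ e, T c e ∧ T b e ∧ e a ≠ 0
  · obtain ⟨e, hec, hea, heb⟩ := h1'
    have h2 : T c (h - (h a / e a) • e) := hT.sub hh (hT.smul _ hec)
    have h3 : T a (h - (h a / e a) • e) := hT.r1 h2 hfa (by simp [heb]) hfac
    have := Submodule.add_mem_sup (S := hT.F a) (T := hT.F b) h3 (hT.smul (h a / e a) hea)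
    simpa using this
  push Not at h1 h1'
  have hDc : ∀ d, T a d → T b d → d c = 0 := by
    intro d hda hdb
    by_contra hdc
    have h2 : T a (f - (f c / d c) • d) := hT.sub hf (hT.smul _ hda)
    have h3 : T c (f - (f c / d c) • d) := hT.r1 h2 hh (by simp [hdc]) hha
    have := h1 _ h3 h2
    simp [hT.perp hdb] at this
    exact hfb this
  have hfc : f c ≠ 0 := fun h0 => hfb (h1 _ (hT.r1 hf hh h0 hha) hf)
  have hgc : g c ≠ 0 := fun h0 => hga (h1' _ (hT.r1 hg hh h0 hhb) hg)
  -- choose d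
  have hd : ∃ d d' δ, T d d' ∧ T a δ ∧ T b δ ∧ δ d ≠ 0 ∧ d' b ≠ 0 ∧ d' c ≠ 0 := by
    have : ∃ d d' δ, T d d' ∧ T a δ ∧ T b δ ∧ δ d ≠ 0 ∧ (d' a ≠ 0 ∨ d' b ≠ 0) := by
      by_contra! hcon
      have := hT.irrDual (hT.F a ⊓ hT.F b) (by
        intro d d' hd e he hed
        obtain ⟨h2, h3⟩ := hcon d d' e hd he.1 he.2 hed
        refine ⟨hT.r1 hd he.1 h2 hed, hT.r1 hd he.2 h3 hed⟩)
      rcases this with h2 | h2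
      · have : δ ∈ hT.F a ⊓ hT.F b := ⟨hδa, hδb⟩
        rw [h2] at this
        exact hδ this
      · have : g ∈ hT.F a ⊓ hT.F b := by rw [h2]; trivial
        exact hga (hT.perp this.1)
    obtain ⟨d, d', δ, hd, hδa, hδb, hδd, hor⟩ := this
    by_cases hda : d' a = 0
    · have hdb : d' b ≠ 0 := by tauto
      by_cases hdc : d' c = 0
      · refine ⟨_, _, δ, hT.conj hd hg, hδa, hδb, ?_, ?_, ?_⟩
        · simpa [hT.perp hδb] using hδd
        · simpa [hT.perp hg] using hdb
        · simp [hdc, hdb, hgc]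
      · exact ⟨d, d', δ, hd, hδa, hδb, hδd, hdb, hdc⟩
    · obtain ⟨s, hs1, hs2⟩ := hK (d' b / (d' a * f b)) (d' c / (d' a * f c))
      refine ⟨_, _, δ, hT.conj' s hd hf, hδa, hδb, ?_, ?_, ?_⟩
      · simpa [hT.perp hδa] using hδd
      · intro h0
        apply hs1
        simp at h0
        field_simp
        linear_combination -h0
      · intro h0
        apply hs2
        simp at h0
        field_simp
        linear_combination -h0
  obtain ⟨d, d', δ, hd, hδa, hδb, hδd, hdb, hdc⟩ := hd
  have hδc : T c δ := hT.r1 hδa hh (hDc δ hδa hδb) hha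
  have hgb : T b (g - (g d / δ d) • δ) := hT.sub hg (hT.smul _ hδb)
  have hhc : T c (h - (h d / δ d) • δ) := hT.sub hh (hT.smul _ hδc)
  have hgd : T d (g - (g d / δ d) • δ) := hT.r1 hgb hd (by simp [hδd]) hdb
  have hhd : T d (h - (h d / δ d) • δ) := hT.r1 hhc hd (by simp [hδd]) hdc
  have he : T d ((h - (h d / δ d) • δ) - (h a / g a) • (g - (g d / δ d) • δ)) :=
    hT.sub hhd (hT.smul _ hgd)
  have hea := hT.r1 he hδa (by simp [hT.perp hδa, hga]) hδd
  have := Submodule.add_mem_sup (S := hT.F a) (T := hT.F b)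
    (hT.addR hea (hT.smul (h d / δ d) hδa)) (hT.smul (h a / g a) hgb)
  convert this using 1
  abel

theorem mem_E' (hT : TSys T) (hK : ∀ u v : K, ∃ s, s ≠ u ∧ s ≠ v) {a b c : V} {f g h δ : Dual K V}
    (ha : hT.IsMax a) (hb : hT.IsMax b)
    (hf : T a f) (hfb : f b ≠ 0) (hg : T b g) (hga : g a ≠ 0)
    (hδa : T a δ) (hδb : T b δ) (hδ : δ ≠ 0)
    (hc : c ≠ 0) (hh : T c h) (hha : h a ≠ 0) : h ∈ hT.F a ⊔ hT.F b := by
  by_cases hhb : h b = 0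
  · have h1 := hT.conj hh hf
    have hc' : c + f c • a ≠ 0 := by
      intro h0
      have h2 : h (c + f c • a) = 0 := by rw [h0]; simp
      simp [hT.perp hh, hha] at h2
      rw [h2] at h0; simp at h0; exact hc h0
    have := hT.mem_E hK ha hb hf hfb hg hga hδa hδb hδ hc' h1 (by simpa [hT.perp hf] using hha)
      (by simp [hhb, hha, hfb])
    have h3 := Submodule.add_mem _ this
      (Submodule.mem_sup_left (T := hT.F b) (hT.smul (h a) hf : h a • f ∈ hT.F a))
    simpa using h3
  · exact hT.mem_E hK ha hb hf hfb hg hga hδa hδb hδ hc hh hha hhb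

theorem full_of_two (hT : TSys T) (hK : ∀ u v : K, ∃ s, s ≠ u ∧ s ≠ v) {x : V} (hx : x ≠ 0)
    (h2 : 2 ≤ finrank K (hT.F x)) : ∃ a, a ≠ 0 ∧ ∀ f : Dual K V, f a = 0 → T a f := by
  obtain ⟨a, ha, hxa⟩ := hT.exists_max hx
  have h2a := h2.trans hxa
  have : ∃ b g, T b g ∧ b ≠ 0 ∧ g a ≠ 0 := by
    by_contra! hcon
    have := hT.irr (Submodule.span K {a}) (by
      intro b g hbg w hw
      obtain ⟨s, rfl⟩ := Submodule.mem_span_singleton.1 hw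
      by_cases hb : b = 0
      · simp [hb]
      · simp [hcon b g hbg hb])
    rcases this with h | h
    · exact ha.1 (by simpa using h)
    · have : hT.F a = ⊥ := by
        rw [eq_bot_iff]
        intro f hf
        rw [Submodule.mem_bot]
        ext y
        have hy : y ∈ Submodule.span K {a} := by rw [h]; trivial
        obtain ⟨s, rfl⟩ := Submodule.mem_span_singleton.1 hy
        simp [hT.perp hf]
      rw [this] at h2a
      simp at h2a
  obtain ⟨b, g, hg, hb0, hga⟩ := this
  obtain ⟨f, hf, hfb⟩ := hT.max_link ha hb0 hg hga
  have hb := hT.max_of ha hb0 hg hga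
  have hD := hT.finrank_le_inf hf hfb hg hga
  have : hT.F a ⊓ hT.F b ≠ ⊥ := by
    intro h
    rw [h] at hD
    simp at hD
    omega
  obtain ⟨δ, ⟨hδa, hδb⟩, hδ⟩ := Submodule.exists_mem_ne_zero_of_ne_bot this
  have hE : hT.F a ⊔ hT.F b = ⊥ ∨ hT.F a ⊔ hT.F b = ⊤ := by
    apply hT.irrDual
    intro c h hh e he hec
    have hc : c ≠ 0 := by rintro rfl; simp at hec
    by_cases hha : h a = 0
    · by_cases hhb : h b = 0
      · obtain ⟨e1, he1, e2, he2, rfl⟩ := Submodule.mem_sup.1 he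
        by_cases h1 : e1 c = 0
        · have h2 : e2 c ≠ 0 := by simpa [h1] using hec
          exact Submodule.mem_sup_right (hT.r1 hh he2 hhb h2)
        · exact Submodule.mem_sup_left (hT.r1 hh he1 hha h1)
      · rw [sup_comm]
        exact hT.mem_E' hK hb ha hg hga hf hfb hδb hδa hδ hc hh hhb
    · exact hT.mem_E' hK ha hb hf hfb hg hga hδa hδb hδ hc hh hha
  have hE' : hT.F a ⊔ hT.F b = ⊤ := by
    rcases hE with h | h
    · have : δ ∈ hT.F a ⊔ hT.F b := Submodule.mem_sup_left hδa
      rw [h] at this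
      exact absurd this hδ
    · exact h
  refine ⟨a, ha.1, fun e he => ?_⟩
  have : e ∈ hT.F a ⊔ hT.F b := by rw [hE']; trivial
  obtain ⟨e1, he1, e2, he2, rfl⟩ := Submodule.mem_sup.1 this
  refine hT.addR he1 (hT.r1 he2 hf ?_ hfb)
  simpa [hT.perp he1] using he

theorem all_of_full (hT : TSys T) {a : V} (ha : a ≠ 0) (hfull : ∀ f : Dual K V, f a = 0 → T a f) :
    ∀ b (f : Dual K V), f b = 0 → T b f := by
  have hconj : ∀ x b g, (∀ f : Dual K V, f x = 0 → T x f) → T b g →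
      ∀ f : Dual K V, f (x + g x • b) = 0 → T (x + g x • b) f := by
    intro x b g hx hg f hf
    have h1 : T x (f + f b • g) := hx _ (by simpa [mul_comm] using hf)
    have := hT.conj h1 hg
    simpa [hT.perp hg] using this
  have hsm : ∀ x (s : K), (∀ f : Dual K V, f x = 0 → T x f) →
      ∀ f : Dual K V, f (s • x) = 0 → T (s • x) f := by
    intro x s hx f hf
    rw [hT.swap]
    exact hx _ (by simpa using hf)
  let A : Submodule K V :=
    { carrier := {x | ∀ f : Dual K V, f x = 0 → T x f}
      zero_mem' := by
        intro f _
        have := (hT.swap (a := a) (f := f) 0).2 (by simpa using hT.zero a)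
        simpa using this
      smul_mem' := fun s x hx => hsm x s hx
      add_mem' := by
        intro x y hx hy
        by_cases h : x ∈ Submodule.span K {y}
        · obtain ⟨s, rfl⟩ := Submodule.mem_span_singleton.1 h
          have : s • y + y = (s + 1) • y := by rw [add_smul, one_smul]
          rw [this]
          exact hsm y _ hy
        · obtain ⟨g, hgx, hgy⟩ := Submodule.exists_dual_map_eq_bot_of_notMem h inferInstance
          have hy0 : g y = 0 := by
            have : g y ∈ (Submodule.span K {y}).map g :=
              Submodule.mem_map_of_mem (Submodule.mem_span_singleton_self y)
            rw [hgy] at this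
            simpa using this
          have := hconj x y ((g x)⁻¹ • g) hx (hT.smul _ (hy g hy0))
          simpa [hgx] using this }
  have hA := hT.irr A (by
    intro b g hbg w hw
    have h1 : w + g w • b ∈ A := hconj w b g hw hbg
    have := A.sub_mem h1 hw
    simpa using this)
  have hAt : A = ⊤ := by
    rcases hA with h | h
    · have : a ∈ A := hfull
      rw [h] at this
      exact absurd this ha
    · exact h
  intro b
  have : b ∈ A := by rw [hAt]; trivial
  exact this

end TSys

namespace TSys

set_option linter.unusedSectionVars false

variable {K V : Type*} [Field K] [AddCommGroup V] [Module K V] [FiniteDimensional K V]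
  {T : V → Dual K V → Prop}

theorem submodule_le_one {K M : Type*} [Field K] [AddCommGroup M] [Module K M]
    [FiniteDimensional K M] (S : Submodule K M) (h : finrank K S ≤ 1) :
    ∃ v : S, ∀ w : S, ∃ c : K, c • v = w :=
  finrank_le_one_iff.1 h

theorem sym_zero (hT : TSys T) (hU : ∀ a : V, a ≠ 0 → finrank K (hT.F a) ≤ 1)
    {a b : V} {f g : Dual K V} (hf : T a f) (hg : T b g) (hb : b ≠ 0) (hf0 : f ≠ 0)
    (h : f b = 0) : g a = 0 := by
  by_contra hga
  have h1 := hT.r1 hf hg h hga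
  obtain ⟨⟨v, hv⟩, hv2⟩ := submodule_le_one (hT.F b) (hU b hb)
  obtain ⟨s, hs⟩ := hv2 ⟨f, h1⟩
  obtain ⟨t, ht⟩ := hv2 ⟨g, hg⟩
  replace hs : s • v = f := congrArg Subtype.val hs
  replace ht : t • v = g := congrArg Subtype.val ht
  have h3 : t * v a ≠ 0 := by rw [← ht] at hga; simpa using hga
  have h4 : s * v a = 0 := by have := hT.perp hf; rw [← hs] at this; simpa using this
  have h5 : s = 0 := by
    rcases mul_eq_zero.1 h4 with h | h
    · exact h
    · rw [h] at h3; simp at h3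
  rw [h5] at hs
  exact hf0 (by rw [← hs]; simp)

/-- normalized pairs relative to a fixed `(a0, f0)` -/
def Nrm (T : V → Dual K V → Prop) (a0 : V) (f0 : Dual K V) (c : V) (g : Dual K V) : Prop :=
  T c g ∧ f0 c ≠ 0 ∧ g a0 = - f0 c

theorem nrm_skew (hT : TSys T) (hU : ∀ a : V, a ≠ 0 → finrank K (hT.F a) ≤ 1)
    {a0 : V} {f0 : Dual K V} (h0 : T a0 f0) {b c : V} {g h : Dual K V}
    (hb : Nrm T a0 f0 b g) (hc : Nrm T a0 f0 c h) : g c = - h b := by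
  obtain ⟨hb1, hb2, hb3⟩ := hb
  obtain ⟨hc1, hc2, hc3⟩ := hc
  have h1 := hT.conj' (g c / f0 b / f0 c) hc1 h0
  have hne : c + (g c / f0 b / f0 c * f0 c) • a0 ≠ 0 := by
    intro h
    have := congrArg f0 h
    simp [hT.perp h0] at this
    exact hc2 this
  have hg0 : g ≠ 0 := by
    rintro rfl
    simp at hb3
    exact hb2 hb3
  have := hT.sym_zero hU hb1 h1 hne hg0 (by
    simp [hb3]
    field_simp
    ring)
  simp [hc3] at this
  field_simp at this
  linear_combination this

theorem exists_nrm (hT : TSys T) (hU : ∀ a : V, a ≠ 0 → finrank K (hT.F a) ≤ 1)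
    {a0 : V} {f0 : Dual K V} (ha0 : a0 ≠ 0) {c : V} {h : Dual K V} (h0 : T a0 f0)
    (hc : T c h) (hh : h ≠ 0) (hfc : f0 c ≠ 0) : ∃ s : K, s ≠ 0 ∧ Nrm T a0 f0 c (s • h) := by
  have h1 : h a0 ≠ 0 := fun h2 => hfc (hT.sym_zero hU hc h0 ha0 hh h2)
  refine ⟨- f0 c / h a0, by simp [hfc, h1], hT.smul _ hc, hfc, ?_⟩
  simp [h1]

theorem symp (hT : TSys T) (hK : ∀ u v : K, ∃ s, s ≠ u ∧ s ≠ v)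
    (hU : ∀ a : V, a ≠ 0 → finrank K (hT.F a) ≤ 1)
    {a0 : V} {f0 : Dual K V} (h0 : T a0 f0) (ha0 : a0 ≠ 0) (hf0 : f0 ≠ 0) :
    ∃ J : V →ₗ[K] Dual K V, LinearMap.ker J = ⊥ ∧
      ∀ c h, T c h → ∀ x y, h y * J x c + h x * J c y = 0 := by
  -- the normalized centers span
  have hex : ∃ c g, Nrm T a0 f0 c g := by
    by_contra! hcon
    have := hT.irr (LinearMap.ker f0) (by
      intro b g hg w hw
      by_cases hg0 : g = 0
      · simp [hg0]
      · have : f0 b = 0 := by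
          by_contra hfb
          obtain ⟨s, _, hs⟩ := hT.exists_nrm hU ha0 h0 hg hg0 hfb
          exact hcon _ _ hs
        simp [this])
    rcases this with h | h
    · have : a0 ∈ LinearMap.ker f0 := hT.perp h0
      rw [h] at this
      exact ha0 this
    · exact hf0 (LinearMap.ker_eq_top.1 h)
  obtain ⟨c0, g0, hc0⟩ := hex
  have hspan : Submodule.span K {c | ∃ g, Nrm T a0 f0 c g} = ⊤ := by
    have := hT.irr (Submodule.span K {c | ∃ g, Nrm T a0 f0 c g}) (by
      intro b g hg w hw
      induction hw using Submodule.span_induction with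
      | zero => simp
      | add x y _ _ hx hy => rw [map_add, add_smul]; exact Submodule.add_mem _ hx hy
      | smul s x _ hx =>
        rw [map_smul, smul_assoc]; exact Submodule.smul_mem _ _ hx
      | mem c hc =>
        obtain ⟨h, hh⟩ := hc
        by_cases hgc : g c = 0
        · simp [hgc]
        obtain ⟨s, hs0, hs1⟩ := hK 0 (- f0 c / (g c * f0 b))
        have h1 := hT.conj' s hh.1 hg
        have h2 : f0 (c + (s * g c) • b) ≠ 0 := by
          by_cases hfb : f0 b = 0
          · simpa [hfb] using hh.2.1
          · intro h3
            apply hs1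
            simp at h3
            field_simp
            linear_combination h3
        have hh0 : h ≠ 0 := by
          rintro rfl
          have := hh.2.2
          simp at this
          exact hh.2.1 this
        have h3 : h - (s * h b) • g ≠ 0 := by
          intro h3
          have h4 := congrArg (fun e : Dual K V => e b) h3
          simp [hT.perp hg] at h4
          rw [h4] at h3
          simp at h3
          exact hh0 h3
        obtain ⟨t, _, ht⟩ := hT.exists_nrm hU ha0 h0 h1 h3 h2
        have m1 : c + (s * g c) • b ∈ Submodule.span K {c | ∃ g, Nrm T a0 f0 c g} :=
          Submodule.subset_span ⟨_, ht⟩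
        have m2 : c ∈ Submodule.span K {c | ∃ g, Nrm T a0 f0 c g} :=
          Submodule.subset_span ⟨_, hh⟩
        have m3 := Submodule.smul_mem _ s⁻¹ (Submodule.sub_mem _ m1 m2)
        rw [add_sub_cancel_left, smul_smul, ← mul_assoc, inv_mul_cancel₀ hs0, one_mul] at m3
        exact m3)
    rcases this with h | h
    · have : c0 ∈ Submodule.span K {c | ∃ g, Nrm T a0 f0 c g} := Submodule.subset_span ⟨_, hc0⟩
      rw [h, Submodule.mem_bot] at this
      have h2 := hc0.2.1
      rw [this] at h2
      simp at h2
    · exact h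
  let B := Module.Basis.ofSpan hspan.ge
  have hB : ∀ i, ∃ g, Nrm T a0 f0 (B i) g := fun i =>
    Module.Basis.ofSpan_subset hspan.ge ⟨i, rfl⟩
  choose gB hgB using hB
  let J : V →ₗ[K] Dual K V := B.constr K gB
  have hJB : ∀ i, J (B i) = gB i := fun i => B.constr_basis K gB i
  have hJ1 : ∀ c h, Nrm T a0 f0 c h → ∀ x, J x c = - h x := by
    intro c h hc x
    have : (LinearMap.applyₗ c).comp J = -h := by
      apply B.ext
      intro i
      simp only [LinearMap.comp_apply, hJB, LinearMap.applyₗ_apply_apply, LinearMap.neg_apply]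
      exact hT.nrm_skew hU h0 (hgB i) hc
    exact congrArg (fun e : Dual K V => e x) this
  have hext : ∀ e e' : Dual K V, (∀ c h, Nrm T a0 f0 c h → e c = e' c) → e = e' := by
    intro e e' he
    apply LinearMap.ext_on hspan
    rintro c ⟨h, hc⟩
    exact he c h hc
  have hJ2 : ∀ c h, Nrm T a0 f0 c h → J c = h := by
    intro c h hc
    apply hext
    intro d k hd
    rw [hJ1 d k hd c, hT.nrm_skew hU h0 hc hd]
  have hskew : ∀ x y, J x y = - J y x := by
    intro x y
    have : J x = - (LinearMap.applyₗ x).comp J := by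
      apply hext
      intro c h hc
      rw [hJ1 c h hc x]
      simp [hJ2 c h hc]
    rw [this]
    simp
  have hlam : ∀ c h, T c h → h ≠ 0 → ∃ l : K, J c = l • h := by
    intro c h hc hh
    by_cases hc0 : c = 0
    · exact ⟨0, by simp [hc0]⟩
    by_cases hfc : f0 c = 0
    · have hha : h a0 = 0 := hT.sym_zero hU h0 hc hc0 hf0 hfc
      have : ∃ b g, Nrm T a0 f0 b g ∧ h b ≠ 0 := by
        by_contra! hcon
        exact hh (hext h 0 (fun c k hk => by simpa using hcon c k hk))
      obtain ⟨b, g, hb, hhb⟩ := this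
      have h1 := hT.conj hb.1 hc
      have h2 : Nrm T a0 f0 (b + h b • c) (g - g c • h) :=
        ⟨h1, by simpa [hfc] using hb.2.1, by simp [hfc, hha, hb.2.2]⟩
      have h3 := hJ2 _ _ h2
      rw [map_add, hJ2 _ _ hb, map_smul] at h3
      refine ⟨- (g c) / h b, ?_⟩
      have h4 : h b • J c = - (g c • h) := by
        rw [sub_eq_add_neg] at h3
        exact add_left_cancel h3
      rw [← inv_smul_smul₀ hhb (J c), h4]
      ext y
      simp
      field_simp
    · obtain ⟨s, _, hs⟩ := hT.exists_nrm hU ha0 h0 hc hh hfc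
      exact ⟨s, hJ2 _ _ hs⟩
  have hinv : ∀ c h, T c h → ∀ x y, h y * J x c + h x * J c y = 0 := by
    intro c h hc x y
    by_cases hh : h = 0
    · simp [hh]
    obtain ⟨l, hl⟩ := hlam c h hc hh
    rw [hskew x c, hl]
    simp
    ring
  refine ⟨J, ?_, hinv⟩
  have := hT.irr (LinearMap.ker J) (by
    intro c h hc x hx
    rw [LinearMap.mem_ker] at hx ⊢
    ext y
    have := hinv c h hc x y
    rw [hx] at this
    simpa using this)
  rcases this with h | h
  · exact h
  · have h1 : J c0 = 0 := by
      have : c0 ∈ LinearMap.ker J := by rw [h]; trivial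
      exact this
    rw [hJ2 _ _ hc0] at h1
    have := hc0.2.2
    rw [h1] at this
    simp at this
    exact absurd this hc0.2.1

/-- McLaughlin-type dichotomy. -/
theorem dichotomy (hT : TSys T) (hK : ∀ u v : K, ∃ s, s ≠ u ∧ s ≠ v) (hV : 2 ≤ finrank K V) :
    (∀ b (f : Dual K V), f b = 0 → T b f) ∨
    ∃ J : V →ₗ[K] Dual K V, LinearMap.ker J = ⊥ ∧
      ∀ c h, T c h → ∀ x y, h y * J x c + h x * J c y = 0 := by
  by_cases hU : ∀ a : V, a ≠ 0 → finrank K (hT.F a) ≤ 1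
  · right
    have : ∃ a f, T a f ∧ a ≠ 0 ∧ f ≠ 0 := by
      by_contra! hcon
      have : Nontrivial V := Module.nontrivial_of_finrank_pos (R := K) (by omega)
      obtain ⟨v, hv⟩ := exists_ne (0 : V)
      have := hT.irr (Submodule.span K {v}) (by
        intro b g hg w hw
        by_cases hb : b = 0
        · simp [hb]
        · simp [hcon b g hg hb])
      rcases this with h | h
      · exact hv (by simpa using h)
      · have h1 := finrank_span_singleton (K := K) hv
        rw [h, finrank_top] at h1
        omega
    obtain ⟨a, f, h, ha, hf⟩ := this
    exact hT.symp hK hU h ha hf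
  · left
    push Not at hU
    obtain ⟨x, hx, h2⟩ := hU
    obtain ⟨a, ha, hfull⟩ := hT.full_of_two hK hx h2
    exact hT.all_of_full ha hfull

end TSys

section PartC

variable {p m : ℕ} [Fact p.Prime]

/-- `TG G a f`: the transvection `1 + a ⊗ f` lies in `G`. -/
def TG (G : Subgroup (Matrix.SpecialLinearGroup (Fin m) (ZMod p)))
    (a : Fin m → ZMod p) (f : Dual (ZMod p) (Fin m → ZMod p)) : Prop :=
  f a = 0 ∧ ∃ g ∈ G, ∀ x : Fin m → ZMod p, g • x = x + f x • a

theorem TG_smul (G : Subgroup (Matrix.SpecialLinearGroup (Fin m) (ZMod p)))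
    {a : Fin m → ZMod p} {f : Dual (ZMod p) (Fin m → ZMod p)} (s : ZMod p) (h : TG G a f) :
    TG G a (s • f) := by
  obtain ⟨h0, g, hg, h⟩ := h
  refine ⟨by simp [h0], g ^ s.val, G.pow_mem hg _, ?_⟩
  have key : ∀ (k : ℕ) (x : Fin m → ZMod p), g ^ k • x = x + (k : ZMod p) • f x • a := by
    intro k
    induction k with
    | zero => intro x; simp
    | succ k ih =>
      intro x
      rw [pow_succ, mul_smul, h, ih]
      simp only [map_add, map_smul, h0, smul_eq_mul, mul_zero, add_zero, Nat.cast_add, Nat.cast_one,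
        add_smul, one_smul]
      abel
  intro x
  rw [key, ZMod.natCast_zmod_val]
  simp [mul_smul]

theorem TG_tsys (G : Subgroup (Matrix.SpecialLinearGroup (Fin m) (ZMod p)))
    (hgen : G ≤ Subgroup.closure {g | g ∈ G ∧ ∃ (a : Fin m → ZMod p)
      (f : Dual (ZMod p) (Fin m → ZMod p)), f a = 0 ∧ ∀ x, g • x = x + f x • a})
    (hspan : Submodule.span (ZMod p) ((fun g : Matrix.SpecialLinearGroup (Fin m) (ZMod p) =>
      (g : Matrix (Fin m) (Fin m) (ZMod p))) '' (G : Set _)) = ⊤) : TSys (TG G) where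
  perp := fun h => h.1
  zero := fun a => ⟨by simp, 1, G.one_mem, by simp⟩
  smul := fun s h => TG_smul G s h
  swap := by
    intro a f s
    by_cases hs : s = 0
    · subst hs
      simp only [TG, zero_smul, map_zero, smul_zero, LinearMap.zero_apply]
    · simp only [TG, map_smul, LinearMap.smul_apply, smul_eq_mul]
      simp only [smul_smul, mul_comm]
  addR := by
    rintro a f g ⟨h1, u, hu, h2⟩ ⟨h3, v, hv, h4⟩
    refine ⟨by simp [h1, h3], u * v, G.mul_mem hu hv, fun x => ?_⟩
    rw [mul_smul, h4, h2]
    simp only [map_add, map_smul, h1, smul_zero, add_zero, LinearMap.add_apply, add_smul]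
    abel
  addL := by
    rintro a b f ⟨h1, u, hu, h2⟩ ⟨h3, v, hv, h4⟩
    refine ⟨by simp [h1, h3], u * v, G.mul_mem hu hv, fun x => ?_⟩
    rw [mul_smul, h4, h2]
    simp only [map_add, map_smul, h3, smul_zero, add_zero, smul_add]
    abel
  conj := by
    rintro a f b g ⟨h1, u, hu, h2⟩ ⟨h3, v, hv, h4⟩
    refine ⟨by simp [h1, h3]; ring, v * u * v⁻¹, G.mul_mem (G.mul_mem hv hu) (G.inv_mem hv),
      fun x => ?_⟩
    have hvinv : v⁻¹ • x = x - g x • b := by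
      rw [inv_smul_eq_iff, h4]
      simp [h3]
    rw [mul_smul, mul_smul, hvinv, h2, h4]
    ext i
    simp only [map_sub, map_add, map_smul, h3, LinearMap.sub_apply,
      LinearMap.smul_apply, Pi.add_apply, Pi.sub_apply, Pi.smul_apply, smul_eq_mul]
    ring
  irr := by
    intro W hW
    have hG : ∀ g ∈ G, ∀ w ∈ W, g • w ∈ W := by
      intro g hg
      have : ∀ w ∈ W, g • w ∈ W ∧ g⁻¹ • w ∈ W := by
        refine Subgroup.closure_induction (p := fun g _ => ∀ w ∈ W, g • w ∈ W ∧ g⁻¹ • w ∈ W)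
          ?_ ?_ ?_ ?_ (hgen hg)
        · rintro g ⟨hg, a, f, h1, h2⟩ w hw
          have hm := hW a f ⟨h1, g, hg, h2⟩ w hw
          constructor
          · rw [h2]; exact W.add_mem hw hm
          · have : g⁻¹ • w = w - f w • a := by
              rw [inv_smul_eq_iff, h2]
              simp [h1]
            rw [this]; exact W.sub_mem hw hm
        · intro w hw; simpa using hw
        · intro x y _ _ hx hy w hw
          refine ⟨?_, ?_⟩
          · rw [mul_smul]; exact (hx _ (hy _ hw).1).1
          · rw [_root_.mul_inv_rev, mul_smul]; exact (hy _ (hx _ hw).2).2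
        · intro x _ hx w hw
          rw [inv_inv]
          exact (hx w hw).symm
      exact fun w hw => (this w hw).1
    have hall : ∀ M : Matrix (Fin m) (Fin m) (ZMod p), ∀ w ∈ W, M *ᵥ w ∈ W := by
      intro M w hw
      have hM : M ∈ Submodule.span (ZMod p)
        ((fun g : Matrix.SpecialLinearGroup (Fin m) (ZMod p) =>
          (g : Matrix (Fin m) (Fin m) (ZMod p))) '' (G : Set _)) := by rw [hspan]; trivial
      induction hM using Submodule.span_induction with
      | mem x hx =>
        obtain ⟨g, hg, rfl⟩ := hx
        exact hG g hg w hw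
      | zero => simp
      | add x y _ _ hx hy => rw [Matrix.add_mulVec]; exact W.add_mem hx hy
      | smul a x _ hx => rw [Matrix.smul_mulVec]; exact W.smul_mem _ hx
    by_cases hb : W = ⊥
    · exact Or.inl hb
    · right
      obtain ⟨w, hw, hw0⟩ := Submodule.exists_mem_ne_zero_of_ne_bot hb
      obtain ⟨i, hi⟩ := Function.ne_iff.1 hw0
      rw [eq_top_iff]
      intro v _
      have := hall (vecMulVec v (Pi.single i (w i)⁻¹)) w hw
      rw [vecMulVec_mulVec] at this
      simpa [show w i ≠ 0 from hi] using this

theorem transvection_smul {i j : Fin m} (hij : i ≠ j) (c : ZMod p) (x : Fin m → ZMod p) :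
    Matrix.SpecialLinearGroup.transvection hij c • x = x + Pi.single i (c * x j) := by
  rw [Matrix.SpecialLinearGroup.smul_def, Matrix.SpecialLinearGroup.transvection_coe]
  change (1 + Matrix.single i j c) *ᵥ x = _
  rw [Matrix.add_mulVec, Matrix.one_mulVec, Matrix.single_mulVec]
  rfl

theorem SL_ext_smul {g h : Matrix.SpecialLinearGroup (Fin m) (ZMod p)}
    (H : ∀ x : Fin m → ZMod p, g • x = h • x) : g = h := by
  apply Subtype.ext
  apply Matrix.ext_of_mulVec_single
  intro k
  exact H (Pi.single k 1)

theorem transvection_mem_of_all {G : Subgroup (Matrix.SpecialLinearGroup (Fin m) (ZMod p))}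
    (hall : ∀ b (f : Dual (ZMod p) (Fin m → ZMod p)), f b = 0 → TG G b f)
    {i j : Fin m} (hij : i ≠ j) (c : ZMod p) :
    Matrix.SpecialLinearGroup.transvection hij c ∈ G := by
  obtain ⟨-, g, hg, h⟩ := hall (Pi.single i c) (LinearMap.proj j) (by simp [hij.symm])
  have : Matrix.SpecialLinearGroup.transvection hij c = g := by
    apply SL_ext_smul
    intro x
    rw [h, transvection_smul]
    congr 1
    ext k
    simp [Pi.single_apply, mul_comm]
  rwa [this]

theorem diag2n_decomp {i j : Fin m} (hij : i ≠ j) (a : ZMod p) (ha : a ≠ 0) :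
    Matrix.SpecialLinearGroup.diag2n hij a ha =
      Matrix.SpecialLinearGroup.transvection hij a *
      Matrix.SpecialLinearGroup.transvection hij.symm (-a⁻¹) *
      Matrix.SpecialLinearGroup.transvection hij a *
      Matrix.SpecialLinearGroup.transvection hij (-1) *
      Matrix.SpecialLinearGroup.transvection hij.symm 1 *
      Matrix.SpecialLinearGroup.transvection hij (-1) := by
  apply SL_ext_smul
  intro x
  have hd : Matrix.SpecialLinearGroup.diag2n hij a ha • x =
      fun k => (if k = i then a else if k = j then a⁻¹ else 1) * x k := by
    rw [Matrix.SpecialLinearGroup.smul_def, Matrix.SpecialLinearGroup.diag2n_coe]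
    ext k
    exact Matrix.mulVec_diagonal _ _ _
  rw [hd]
  simp only [mul_smul, transvection_smul]
  ext k
  by_cases h1 : k = i
  · subst h1
    simp [hij, hij.symm]
    field_simp
    ring
  · by_cases h2 : k = j
    · subst h2
      simp [hij, hij.symm]
      field_simp
      ring
    · simp [h1, h2]

theorem eq_top_of_all {G : Subgroup (Matrix.SpecialLinearGroup (Fin m) (ZMod p))} (hm : 2 ≤ m)
    (hall : ∀ b (f : Dual (ZMod p) (Fin m → ZMod p)), f b = 0 → TG G b f) : G = ⊤ := by
  have : Nontrivial (Fin m) := Fin.nontrivial_iff_two_le.2 hm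
  have ht : ∀ {i j : Fin m} (hij : i ≠ j) (c : ZMod p),
    Matrix.SpecialLinearGroup.transvection hij c ∈ G :=
      fun hij c => transvection_mem_of_all hall hij c
  rw [eq_top_iff]
  intro g _
  refine Matrix.SpecialLinearGroup.diagonal_transvection_induction' (fun g => g ∈ G) g ?_
    (fun i j hij a => ht hij a) (fun A B hA hB => G.mul_mem hA hB)
  intro i j hij c hc
  change _ ∈ G
  rw [diag2n_decomp]
  exact G.mul_mem (G.mul_mem (G.mul_mem (G.mul_mem (G.mul_mem (ht _ _) (ht _ _)) (ht _ _))
    (ht _ _)) (ht _ _)) (ht _ _)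

theorem trace_eq_of_form {G : Subgroup (Matrix.SpecialLinearGroup (Fin m) (ZMod p))}
    (hgen : G ≤ Subgroup.closure {g | g ∈ G ∧ ∃ (a : Fin m → ZMod p)
      (f : Dual (ZMod p) (Fin m → ZMod p)), f a = 0 ∧ ∀ x, g • x = x + f x • a})
    (J : (Fin m → ZMod p) →ₗ[ZMod p] Dual (ZMod p) (Fin m → ZMod p))
    (hJ : LinearMap.ker J = ⊥)
    (hT : ∀ c h, TG G c h → ∀ x y, h y * J x c + h x * J c y = 0)
    {g : Matrix.SpecialLinearGroup (Fin m) (ZMod p)} (hg : g ∈ G) :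
    (g : Matrix (Fin m) (Fin m) (ZMod p)).trace =
      ((g⁻¹ : Matrix.SpecialLinearGroup (Fin m) (ZMod p)) :
        Matrix (Fin m) (Fin m) (ZMod p)).trace := by
  have hinv : ∀ x y, J (g • x) (g • y) = J x y := by
    refine Subgroup.closure_induction (p := fun g _ => ∀ x y, J (g • x) (g • y) = J x y)
      ?_ ?_ ?_ ?_ (hgen hg)
    · rintro g ⟨hg, a, f, h1, h2⟩ x y
      have h3 := hT a f ⟨h1, g, hg, h2⟩
      have h4 := h3 x a
      rw [h1, zero_mul, zero_add] at h4
      rw [h2, h2]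
      simp only [map_add, map_smul, LinearMap.add_apply, LinearMap.smul_apply, smul_eq_mul]
      linear_combination h3 x y + f y * h4
    · intro x y; simp
    · intro u v _ _ hu hv x y
      rw [mul_smul, mul_smul, hu, hv]
    · intro u _ hu x y
      rw [← hu]; simp
  have hfr : Module.finrank (ZMod p) (Fin m → ZMod p) =
    Module.finrank (ZMod p) (Dual (ZMod p) (Fin m → ZMod p)) :=
      Subspace.dual_finrank_eq.symm
  let e : (Fin m → ZMod p) ≃ₗ[ZMod p] Dual (ZMod p) (Fin m → ZMod p) :=
    LinearEquiv.ofInjectiveOfFinrankEq J (LinearMap.ker_eq_bot.1 hJ) hfr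
  have he : ∀ x, e x = J x := fun x => rfl
  have hc : e.conj (Matrix.toLin' (g⁻¹ : Matrix.SpecialLinearGroup (Fin m) (ZMod p)).1) =
      Module.Dual.transpose (R := ZMod p) (Matrix.toLin' g.1) := by
    apply LinearMap.ext
    intro f
    obtain ⟨x, rfl⟩ := e.surjective f
    apply LinearMap.ext
    intro y
    rw [LinearEquiv.conj_apply_apply, LinearEquiv.symm_apply_apply]
    change J (g⁻¹ • x) y = J x (g • y)
    rw [← hinv]; simp
  rw [← Matrix.trace_toLin'_eq, ← Matrix.trace_toLin'_eq, ← LinearMap.trace_transpose', ← hc,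
    LinearMap.trace_conj']

theorem eq_top_of_criterion (hp : 3 ≤ p) (hm : 2 ≤ m)
    (G : Subgroup (Matrix.SpecialLinearGroup (Fin m) (ZMod p)))
    (hgen : G ≤ Subgroup.closure {g | g ∈ G ∧ ∃ (a : Fin m → ZMod p)
      (f : Dual (ZMod p) (Fin m → ZMod p)), f a = 0 ∧ ∀ x, g • x = x + f x • a})
    (hspan : Submodule.span (ZMod p) ((fun g : Matrix.SpecialLinearGroup (Fin m) (ZMod p) =>
      (g : Matrix (Fin m) (Fin m) (ZMod p))) '' (G : Set _)) = ⊤)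
    {h : Matrix.SpecialLinearGroup (Fin m) (ZMod p)} (hh : h ∈ G)
    (htr : (h : Matrix (Fin m) (Fin m) (ZMod p)).trace ≠
      ((h⁻¹ : Matrix.SpecialLinearGroup (Fin m) (ZMod p)) :
        Matrix (Fin m) (Fin m) (ZMod p)).trace) : G = ⊤ := by
  have hK : ∀ u v : ZMod p, ∃ s, s ≠ u ∧ s ≠ v := by
    intro u v
    have : ({u, v} : Finset (ZMod p)).card < (Finset.univ : Finset (ZMod p)).card := by
      rw [Finset.card_univ, ZMod.card]
      have := Finset.card_le_two (a := u) (b := v)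
      omega
    obtain ⟨s, -, hs⟩ := Finset.exists_mem_notMem_of_card_lt_card this
    exact ⟨s, by simpa using hs⟩
  rcases (TG_tsys G hgen hspan).dichotomy hK (by simpa using hm) with hall | ⟨J, hJ, hT⟩
  · exact eq_top_of_all hm hall
  · exact absurd (trace_eq_of_form hgen J hJ hT hh) htr

end PartC

end Helpers

section PartD

variable {m : ℕ}

theorem clear_denom (S : Set (SL m ℤ)) {x : Matrix (Fin m) (Fin m) ℚ}
    (hx : x ∈ Submodule.span ℚ (matQ '' S)) :
    ∃ d : ℤ, d ≠ 0 ∧ ∃ y ∈ Submodule.span ℤ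
      ((fun g : SL m ℤ => (g : Matrix (Fin m) (Fin m) ℤ)) '' S),
      (d : ℚ) • x = (Int.castRingHom ℚ).mapMatrix y := by
  induction hx using Submodule.span_induction with
  | mem x hx =>
    obtain ⟨g, hg, rfl⟩ := hx
    exact ⟨1, one_ne_zero, _, Submodule.subset_span ⟨g, hg, rfl⟩, by simp [matQ]⟩
  | zero => exact ⟨1, one_ne_zero, 0, Submodule.zero_mem _, by simp⟩
  | add x y _ _ hx hy =>
    obtain ⟨d, hd, u, hu, h1⟩ := hx
    obtain ⟨e, he, v, hv, h2⟩ := hy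
    refine ⟨d * e, mul_ne_zero hd he, e • u + d • v,
      Submodule.add_mem _ (Submodule.smul_mem _ _ hu) (Submodule.smul_mem _ _ hv), ?_⟩
    rw [map_add, map_zsmul, map_zsmul, ← h1, ← h2, smul_add]
    simp only [← Int.cast_smul_eq_zsmul ℚ, smul_smul, Int.cast_mul, mul_comm]
  | smul a x _ hx =>
    obtain ⟨d, hd, u, hu, h1⟩ := hx
    refine ⟨d * a.den, mul_ne_zero hd (by exact_mod_cast a.den_nz), a.num • u,
      Submodule.smul_mem _ _ hu, ?_⟩
    rw [map_zsmul, ← h1, ← Int.cast_smul_eq_zsmul ℚ, smul_smul, smul_smul]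
    congr 1
    push_cast
    rw [mul_assoc, mul_comm (a.den : ℚ), Rat.mul_den_eq_num, mul_comm]

theorem span_of_absIrred {N : Subgroup (SL m ℤ)} (h : AbsIrredQ N) :
    Submodule.span ℚ (matQ '' (N : Set (SL m ℤ))) = ⊤ := by
  let φ : SL m ℤ →* Matrix (Fin m) (Fin m) ℚ :=
    ((Int.castRingHom ℚ).mapMatrix : Matrix (Fin m) (Fin m) ℤ →+* _).toMonoidHom.comp
      Matrix.SpecialLinearGroup.coeMonoidHom
  have h1 : matQ '' (N : Set (SL m ℤ)) = (N.toSubmonoid.map φ : Set _) := rfl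
  have h2 := congrArg Subalgebra.toSubmodule h
  rw [Algebra.adjoin_eq_span, h1, Submonoid.closure_eq, ← h1] at h2
  simpa using h2

theorem mapMatrix_single_one {R : Type*} [CommRing R] (φ : ℤ →+* R) (i j : Fin m) :
    φ.mapMatrix (Matrix.single i j (1 : ℤ)) = Matrix.single i j (1 : R) := by
  ext k l
  simp only [RingHom.mapMatrix_apply, Matrix.map_apply, Matrix.single_apply]
  split_ifs <;> simp

theorem exists_span_mod {N : Subgroup (SL m ℤ)} (h : AbsIrredQ N) :
    ∃ D : ℤ, D ≠ 0 ∧ ∀ (p : ℕ) [Fact p.Prime], (D : ZMod p) ≠ 0 →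
      Submodule.span (ZMod p) ((fun g : Matrix.SpecialLinearGroup (Fin m) (ZMod p) =>
      (g : Matrix (Fin m) (Fin m) (ZMod p))) '' (N.map (redMod m p) : Set _)) = ⊤ := by
  have h1 : ∀ ij : Fin m × Fin m, ∃ d : ℤ, d ≠ 0 ∧ ∃ y ∈ Submodule.span ℤ
      ((fun g : SL m ℤ => (g : Matrix (Fin m) (Fin m) ℤ)) '' (N : Set (SL m ℤ))),
      (d : ℚ) • Matrix.single ij.1 ij.2 (1 : ℚ) = (Int.castRingHom ℚ).mapMatrix y :=
    fun ij => clear_denom (N : Set (SL m ℤ)) (x := Matrix.single ij.1 ij.2 (1 : ℚ)) (by rw [span_of_absIrred h]; exact Submodule.mem_top)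
  choose d hd y hy hdy using h1
  refine ⟨∏ ij, d ij, Finset.prod_ne_zero_iff.2 fun ij _ => hd ij, ?_⟩
  intro p hpF hp
  rw [Int.cast_prod, Finset.prod_ne_zero_iff] at hp
  set S := Submodule.span (ZMod p) ((fun g : Matrix.SpecialLinearGroup (Fin m) (ZMod p) =>
      (g : Matrix (Fin m) (Fin m) (ZMod p))) '' (N.map (redMod m p) : Set _)) with hS
  have h2 : ∀ y ∈ Submodule.span ℤ
      ((fun g : SL m ℤ => (g : Matrix (Fin m) (Fin m) ℤ)) '' (N : Set (SL m ℤ))),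
      (Int.castRingHom (ZMod p)).mapMatrix y ∈ S := by
    intro y hy
    induction hy using Submodule.span_induction with
    | mem x hx =>
      obtain ⟨g, hg, rfl⟩ := hx
      exact Submodule.subset_span ⟨redMod m p g, ⟨g, hg, rfl⟩, rfl⟩
    | zero => rw [map_zero]; exact S.zero_mem
    | add x y _ _ hx hy => rw [map_add]; exact S.add_mem hx hy
    | smul a x _ hx =>
      rw [map_zsmul, ← Int.cast_smul_eq_zsmul (ZMod p)]
      exact S.smul_mem _ hx
  have h3 : ∀ ij, y ij = d ij • Matrix.single ij.1 ij.2 (1 : ℤ) := by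
    intro ij
    have hinj : Function.Injective
      ((Int.castRingHom ℚ).mapMatrix : Matrix (Fin m) (Fin m) ℤ →+* _) :=
        Matrix.map_injective Int.cast_injective
    apply hinj
    rw [← hdy, map_zsmul, ← Int.cast_smul_eq_zsmul ℚ]
    rw [mapMatrix_single_one]
  have h4 : ∀ i j (c : ZMod p), Matrix.single i j c ∈ S := by
    intro i j c
    have h5 := h2 _ (hy (i, j))
    rw [h3, map_zsmul, ← Int.cast_smul_eq_zsmul (ZMod p)] at h5
    have h6 := S.smul_mem (c * (d (i, j) : ZMod p)⁻¹) h5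
    rw [smul_smul, mul_assoc, inv_mul_cancel₀ (hp _ (Finset.mem_univ _)), mul_one, mapMatrix_single_one,
      Matrix.smul_single, smul_eq_mul, mul_one] at h6
    exact h6
  rw [eq_top_iff]
  intro M _
  rw [Matrix.matrix_eq_sum_single M]
  exact Submodule.sum_mem _ fun i _ => Submodule.sum_mem _ fun j _ => h4 _ _ _

end PartD

section PartE

variable {m : ℕ}

theorem rank_one_form (M : Matrix (Fin m) (Fin m) ℤ) (h : M.rank = 1) :
    ∃ a f : Fin m → ℤ, M = vecMulVec a f ∧ a ≠ 0 ∧ f ≠ 0 := by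
  have hr := h
  rw [Matrix.rank] at h
  obtain ⟨b⟩ := (finrank_eq_one_iff Unit).1 h
  let a : Fin m → ℤ := (b ()).1
  let f : Fin m → ℤ := fun j => b.repr ⟨M *ᵥ Pi.single j 1, ⟨Pi.single j 1, rfl⟩⟩ ()
  have hM : M = vecMulVec a f := by
    apply Matrix.ext_of_mulVec_single
    intro j
    have h1 := b.sum_repr ⟨M *ᵥ Pi.single j 1, ⟨Pi.single j 1, rfl⟩⟩
    have h2 := congrArg Subtype.val h1
    simp only [Finset.univ_unique, Finset.sum_singleton] at h2
    rw [← h2, vecMulVec_mulVec]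
    ext i
    simp [a, f, mul_comm]
  have hM0 : M ≠ 0 := by
    intro h0
    rw [h0, Matrix.rank_zero] at hr
    exact zero_ne_one hr
  refine ⟨a, f, hM, ?_, ?_⟩
  · intro h0; apply hM0; rw [hM, h0]; ext; simp [vecMulVec_apply]
  · intro h0; apply hM0; rw [hM, h0]; ext; simp [vecMulVec_apply]

theorem transvection_form (t : SL m ℤ)
    (htrank : ((t : Matrix (Fin m) (Fin m) ℤ) - 1).rank = 1)
    (htsq : ((t : Matrix (Fin m) (Fin m) ℤ) - 1) ^ 2 = 0) :
    ∃ a f : Fin m → ℤ, (t : Matrix (Fin m) (Fin m) ℤ) = 1 + vecMulVec a f ∧ f ⬝ᵥ a = 0 := by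
  obtain ⟨a, f, h, ha, hf⟩ := rank_one_form _ htrank
  refine ⟨a, f, by rw [← h]; abel, ?_⟩
  rw [h, pow_two, vecMulVec_mul_vecMulVec] at htsq
  obtain ⟨i, hi⟩ := Function.ne_iff.1 ha
  obtain ⟨j, hj⟩ := Function.ne_iff.1 hf
  have := congrFun (congrFun htsq i) j
  simp only [Pi.zero_apply] at hi hj
  simpa [vecMulVec_apply, hi, hj] using this

/-- The reduction modulo `p` of a conjugate of a transvection is a transvection. -/
theorem conj_form {p : ℕ} (t c : SL m ℤ) {a f : Fin m → ℤ}
    (ht : (t : Matrix (Fin m) (Fin m) ℤ) = 1 + vecMulVec a f) (hfa : f ⬝ᵥ a = 0) :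
    ∃ (b : Fin m → ZMod p) (g : Module.Dual (ZMod p) (Fin m → ZMod p)), g b = 0 ∧
      ∀ x, redMod m p (c * t * c⁻¹) • x = x + g x • b := by
  let ψ := Int.castRingHom (ZMod p)
  let a1 : Fin m → ZMod p := fun i => (a i : ZMod p)
  let f1 : Fin m → ZMod p := fun i => (f i : ZMod p)
  let g0 : Module.Dual (ZMod p) (Fin m → ZMod p) := ∑ i, f1 i • LinearMap.proj i
  have hg0 : ∀ x, g0 x = f1 ⬝ᵥ x := fun x => by simp [g0, dotProduct]
  have h0 : g0 a1 = 0 := by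
    rw [hg0]
    have := congrArg ψ hfa
    simpa [dotProduct, ψ] using this
  have h1 : ∀ x : Fin m → ZMod p, redMod m p t • x = x + g0 x • a1 := by
    intro x
    rw [Matrix.SpecialLinearGroup.smul_def]
    have : (redMod m p t : Matrix (Fin m) (Fin m) (ZMod p)) = 1 + vecMulVec a1 f1 := by
      change ψ.mapMatrix t.1 = _
      rw [ht, map_add, map_one]
      congr 1
      ext i j
      simp [vecMulVec_apply, ψ, a1, f1]
    rw [this]
    change (1 + vecMulVec a1 f1) *ᵥ x = _
    rw [add_mulVec, one_mulVec, vecMulVec_mulVec, hg0, op_smul_eq_smul]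
  set u := redMod m p c
  refine ⟨u • a1, g0 ∘ₗ Matrix.toLin' (u⁻¹ : SL m (ZMod p)).1, ?_, ?_⟩
  · change g0 (u⁻¹ • u • a1) = 0
    rw [inv_smul_smul, h0]
  · intro x
    change _ = x + g0 (u⁻¹ • x) • (u • a1)
    rw [map_mul, map_mul, map_inv, mul_smul, mul_smul, h1, smul_add, smul_inv_smul, smul_comm]

end PartE

section PartF

theorem map_eq_top_of_good {m : ℕ} (hm : 2 ≤ m) {H : Subgroup (SL m ℤ)} {t : SL m ℤ}
    (htH : t ∈ H) {a f : Fin m → ℤ}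
    (ht : (t : Matrix (Fin m) (Fin m) ℤ) = 1 + vecMulVec a f) (hfa : f ⬝ᵥ a = 0)
    {N : Subgroup (SL m ℤ)}
    (hN : N = (Subgroup.normalClosure {(⟨t, htH⟩ : H)}).map H.subtype)
    {p : ℕ} (hp : p.Prime) (hp3 : 3 < p)
    (hspan : Submodule.span (ZMod p) ((fun g : Matrix.SpecialLinearGroup (Fin m) (ZMod p) =>
      (g : Matrix (Fin m) (Fin m) (ZMod p))) '' (N.map (redMod m p) : Set _)) = ⊤)
    {h : SL m ℤ} (hh : h ∈ N)
    (htr : (((h : Matrix (Fin m) (Fin m) ℤ).trace -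
      ((h⁻¹ : SL m ℤ) : Matrix (Fin m) (Fin m) ℤ).trace : ℤ) : ZMod p) ≠ 0) :
    H.map (redMod m p) = ⊤ := by
  have : Fact p.Prime := ⟨hp⟩
  have hNH : N ≤ H := by rw [hN]; exact Subgroup.map_subtype_le _
  have htop : N.map (redMod m p) = ⊤ := by
    refine eq_top_of_criterion (by omega) hm _ ?_ hspan (Subgroup.mem_map_of_mem _ hh) ?_
    · have h1 : N.map (redMod m p) = Subgroup.closure (((redMod m p).comp H.subtype) ''
          Group.conjugatesOfSet {(⟨t, htH⟩ : H)}) := by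
        rw [hN, Subgroup.map_map, Subgroup.normalClosure, MonoidHom.map_closure]
      conv_lhs => rw [h1]
      apply Subgroup.closure_mono
      intro g hg
      refine ⟨by rw [h1]; exact Subgroup.subset_closure hg, ?_⟩
      obtain ⟨x, hx, rfl⟩ := hg
      rw [Group.mem_conjugatesOfSet_iff] at hx
      obtain ⟨y, hy, hc⟩ := hx
      rw [Set.mem_singleton_iff] at hy
      subst hy
      obtain ⟨c, rfl⟩ := isConj_iff.1 hc
      exact conj_form t c.1 ht hfa
    · intro heq
      apply htr
      rw [← map_inv] at heq
      have key : ∀ g : SL m ℤ, ((redMod m p g : SL m (ZMod p)) :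
          Matrix (Fin m) (Fin m) (ZMod p)).trace =
          (((g : Matrix (Fin m) (Fin m) ℤ).trace : ℤ) : ZMod p) := by
        intro g
        change ((Int.castRingHom (ZMod p)).mapMatrix g.1).trace = _
        simp [Matrix.trace]
      rw [key, key] at heq
      rw [Int.cast_sub, heq, sub_self]
  rw [eq_top_iff, ← htop]
  exact Subgroup.map_mono hNH

end PartF

/-- If a finitely generated `H ≤ SL(2n,ℤ)` contains a transvection `t` whose
normal closure `N` in `H` is absolutely irreducible over `ℚ` and contains an element `h`
with `tr(h) ≠ tr(h⁻¹)`, then `φ_p(H) = SL(2n,ℤ/pℤ)` for all but finitely many primes `p`;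
in particular for some prime `p > 3`. -/
theorem transvection_criterion_dense (n : ℕ) (hn : 1 ≤ n)
    (H : Subgroup (SL (2 * n) ℤ)) (hFG : H.FG)
    (t : SL (2 * n) ℤ) (htH : t ∈ H)
    (htrank : ((t : Matrix (Fin (2 * n)) (Fin (2 * n)) ℤ) - 1).rank = 1)
    (htsq : ((t : Matrix (Fin (2 * n)) (Fin (2 * n)) ℤ) - 1) ^ 2 = 0)
    (N : Subgroup (SL (2 * n) ℤ))
    (hN : N = (Subgroup.normalClosure {(⟨t, htH⟩ : H)}).map H.subtype)
    (hNirr : AbsIrredQ N)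
    (htr : ∃ h ∈ N, (h : Matrix (Fin (2 * n)) (Fin (2 * n)) ℤ).trace ≠
      ((h⁻¹ : SL (2 * n) ℤ) : Matrix (Fin (2 * n)) (Fin (2 * n)) ℤ).trace) :
    {p : ℕ | p.Prime ∧ H.map (redMod (2 * n) p) ≠ ⊤}.Finite ∧
      ∃ p : ℕ, p.Prime ∧ 3 < p ∧ H.map (redMod (2 * n) p) = ⊤ := by
  obtain ⟨a, f, ht, hfa⟩ := transvection_form t htrank htsq
  obtain ⟨D, hD0, hD⟩ := exists_span_mod hNirr
  obtain ⟨h, hh, htr⟩ := htr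
  set E := (h : Matrix (Fin (2 * n)) (Fin (2 * n)) ℤ).trace -
    ((h⁻¹ : SL (2 * n) ℤ) : Matrix (Fin (2 * n)) (Fin (2 * n)) ℤ).trace with hE
  have hE0 : E ≠ 0 := sub_ne_zero.2 htr
  have hgood : ∀ p : ℕ, p.Prime → 3 < p → D.natAbs < p → E.natAbs < p →
      H.map (redMod (2 * n) p) = ⊤ := by
    intro p hp h3 h1 h2
    have hcast : ∀ z : ℤ, z ≠ 0 → z.natAbs < p → (z : ZMod p) ≠ 0 := by
      intro z hz hlt h0
      rw [ZMod.intCast_zmod_eq_zero_iff_dvd, Int.natCast_dvd] at h0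
      have := Nat.le_of_dvd (Int.natAbs_pos.2 hz) h0
      omega
    have : Fact p.Prime := ⟨hp⟩
    exact map_eq_top_of_good (by omega) htH ht hfa hN hp h3 (hD p (hcast D hD0 h1)) hh
      (hcast E hE0 h2)
  constructor
  · refine (Set.finite_Iic (3 + D.natAbs + E.natAbs)).subset ?_
    rintro p ⟨hp, hne⟩
    by_contra hlt
    rw [Set.mem_Iic] at hlt
    exact hne (hgood p hp (by omega) (by omega) (by omega))
  · obtain ⟨p, hle, hp⟩ := Nat.exists_infinite_primes (3 + D.natAbs + E.natAbs + 1)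
    exact ⟨p, hp, by omega, hgood p hp (by omega) (by omega) (by omega)⟩
end

section
/- Let H ≤ SL(m,ℤ) and let N be a normal subgroup of H that is absolutely irreducible over ℚ. If tr(h) = tr(h⁻¹) for all h ∈ N, then there exists an invertible matrix Φ ∈ GL(m,ℚ) such that for every h ∈ H there is a scalar α ∈ ℚ with h Φ hᵀ = α Φ (i.e., H lies in a similarity group over ℚ). -/
open Matrix

lemma matQ_mul {n : ℕ} (g h : SL n ℤ) : matQ (g * h) = matQ g * matQ h := by
  unfold matQ
  rw [Matrix.SpecialLinearGroup.coe_mul]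
  exact Matrix.map_mul (f := Int.castRingHom ℚ)

lemma matQ_one {n : ℕ} : matQ (1 : SL n ℤ) = 1 := by
  unfold matQ
  simp

lemma matQ_mul_inv {n : ℕ} (g : SL n ℤ) : matQ g * matQ g⁻¹ = 1 := by
  rw [← matQ_mul, mul_inv_cancel, matQ_one]

lemma matQ_inv_mul {n : ℕ} (g : SL n ℤ) : matQ g⁻¹ * matQ g = 1 := by
  rw [← matQ_mul, inv_mul_cancel, matQ_one]

lemma matQ_trace {n : ℕ} (g : SL n ℤ) :
    (matQ g).trace = (((g : Matrix (Fin n) (Fin n) ℤ).trace : ℤ) : ℚ) := by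
  simp [matQ, Matrix.trace]

/-- `g ↦ (g, g⁻ᵀ)`. -/
def rhoPair {n : ℕ} (N : Subgroup (SL n ℤ)) :
    N →* Matrix (Fin n) (Fin n) ℚ × Matrix (Fin n) (Fin n) ℚ where
  toFun g := (matQ (g : SL n ℤ), (matQ (g : SL n ℤ)⁻¹)ᵀ)
  map_one' := by simp [matQ_one]
  map_mul' g h := by simp [matQ_mul, Matrix.transpose_mul]

/-- Algebra automorphisms of the matrix algebra are inner. -/
lemma matrix_aut_inner {n : ℕ} (e : Matrix (Fin n) (Fin n) ℚ ≃ₐ[ℚ] Matrix (Fin n) (Fin n) ℚ) :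
    ∃ P Q : Matrix (Fin n) (Fin n) ℚ, P * Q = 1 ∧ Q * P = 1 ∧ ∀ X, e X = P * X * Q := by
  obtain ⟨T, hT⟩ := AlgEquiv.eq_linearEquivConjAlgEquiv
    ((Matrix.toLinAlgEquiv' (R := ℚ) (n := Fin n)).symm.trans
      (e.trans (Matrix.toLinAlgEquiv' (R := ℚ) (n := Fin n))))
  have h1 : LinearMap.toMatrix' (T : (Fin n → ℚ) →ₗ[ℚ] (Fin n → ℚ)) *
      LinearMap.toMatrix' (T.symm : (Fin n → ℚ) →ₗ[ℚ] (Fin n → ℚ)) = 1 := by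
    rw [← LinearMap.toMatrix'_comp]; simp
  refine ⟨_, _, h1, mul_eq_one_comm.mp h1, fun X => ?_⟩
  have h2 := congrArg LinearMap.toMatrix' (DFunLike.congr_fun hT (Matrix.toLinAlgEquiv' X))
  have h3 : LinearMap.toMatrix' (Matrix.toLinAlgEquiv' (e X)) = e X :=
    LinearMap.toMatrix'_toLin' _
  have h4 : LinearMap.toMatrix' (Matrix.toLinAlgEquiv' X) = X :=
    LinearMap.toMatrix'_toLin' _
  simp only [AlgEquiv.trans_apply, AlgEquiv.symm_apply_apply, LinearEquiv.conjAlgEquiv_apply,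
    LinearMap.toMatrix'_comp, h3, h4] at h2
  rw [h2]
  simp [mul_assoc]

lemma exists_form {m : ℕ} (N : Subgroup (SL m ℤ)) (hNirr : AbsIrredQ N)
    (htr : ∀ h ∈ N, (h : Matrix (Fin m) (Fin m) ℤ).trace =
      ((h⁻¹ : SL m ℤ) : Matrix (Fin m) (Fin m) ℤ).trace) :
    ∃ P Q : Matrix (Fin m) (Fin m) ℚ, P * Q = 1 ∧ Q * P = 1 ∧
      ∀ g ∈ N, (matQ g⁻¹)ᵀ = P * matQ g * Q := by
  set S := Algebra.adjoin ℚ (MonoidHom.mrange (rhoPair N) : Set (Matrix (Fin m) (Fin m) ℚ × Matrix (Fin m) (Fin m) ℚ)) with hS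
  have hmem : ∀ g (hg : g ∈ N), (matQ g, (matQ g⁻¹)ᵀ) ∈ S := fun g hg =>
    Algebra.subset_adjoin ⟨⟨g, hg⟩, rfl⟩
  have htrS : ∀ x ∈ S, x.1.trace = x.2.trace := by
    intro x hx
    have hx' : x ∈ Subalgebra.toSubmodule S := hx
    rw [hS, Algebra.adjoin_eq_span, Submonoid.closure_eq] at hx'
    clear hx
    induction hx' using Submodule.span_induction with
    | mem x h =>
      obtain ⟨g, rfl⟩ := h
      simp only [rhoPair, MonoidHom.coe_mk, OneHom.coe_mk, Matrix.trace_transpose, matQ_trace]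
      rw [htr g g.2]
    | zero => simp
    | add x y _ _ hx hy =>
      simp [*]
    | smul a x _ hx =>
      simp [*]
  have hs1 : ∀ X, ∃ Y, (X, Y) ∈ S := by
    intro X
    have hX : X ∈ Algebra.adjoin ℚ (matQ '' (N : Set (SL m ℤ))) := by
      rw [show Algebra.adjoin ℚ (matQ '' (N : Set (SL m ℤ))) = ⊤ from hNirr]; trivial
    induction hX using Algebra.adjoin_induction with
    | mem x h => obtain ⟨g, hg, rfl⟩ := h; exact ⟨_, hmem g hg⟩
    | algebraMap r => exact ⟨_, S.algebraMap_mem r⟩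
    | add x y _ _ hx hy =>
      obtain ⟨a, ha⟩ := hx
      obtain ⟨b, hb⟩ := hy
      exact ⟨_, S.add_mem ha hb⟩
    | mul x y _ _ hx hy =>
      obtain ⟨a, ha⟩ := hx
      obtain ⟨b, hb⟩ := hy
      exact ⟨_, S.mul_mem ha hb⟩
  have hs2' : ∀ Y : Matrix (Fin m) (Fin m) ℚ, ∃ X, (X, Yᵀ) ∈ S := by
    intro X
    have hX : X ∈ Algebra.adjoin ℚ (matQ '' (N : Set (SL m ℤ))) := by
      rw [show Algebra.adjoin ℚ (matQ '' (N : Set (SL m ℤ))) = ⊤ from hNirr]; trivial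
    induction hX using Algebra.adjoin_induction with
    | mem x h =>
      obtain ⟨g, hg, rfl⟩ := h
      have := hmem g⁻¹ (N.inv_mem hg)
      rw [inv_inv] at this
      exact ⟨_, this⟩
    | algebraMap r =>
      refine ⟨algebraMap ℚ _ r, ?_⟩
      have := S.algebraMap_mem r
      rw [Matrix.algebraMap_eq_diagonal, Matrix.diagonal_transpose, ← Matrix.algebraMap_eq_diagonal]
      exact this
    | add x y _ _ hx hy =>
      obtain ⟨a, ha⟩ := hx
      obtain ⟨b, hb⟩ := hy
      exact ⟨_, S.add_mem ha hb⟩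
    | mul x y _ _ hx hy =>
      obtain ⟨a, ha⟩ := hx
      obtain ⟨b, hb⟩ := hy
      rw [Matrix.transpose_mul]
      exact ⟨_, S.mul_mem hb ha⟩
  have hs2 : ∀ Y, ∃ X, (X, Y) ∈ S := fun Y => by simpa using hs2' Yᵀ
  have hi1 : ∀ Y, ((0 : Matrix (Fin m) (Fin m) ℚ), Y) ∈ S → Y = 0 := by
    intro Y hY
    rw [Matrix.ext_iff_trace_mul_right]
    intro B
    obtain ⟨A, hA⟩ := hs2 B
    simpa using (htrS _ (S.mul_mem hY hA)).symm
  have hi2 : ∀ X, (X, (0 : Matrix (Fin m) (Fin m) ℚ)) ∈ S → X = 0 := by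
    intro Y hY
    rw [Matrix.ext_iff_trace_mul_right]
    intro B
    obtain ⟨A, hA⟩ := hs1 B
    simpa using (htrS _ (S.mul_mem hY hA))
  let e1 : S ≃ₐ[ℚ] Matrix (Fin m) (Fin m) ℚ := AlgEquiv.ofBijective
    ((AlgHom.fst ℚ _ _).comp S.val) (by
      constructor
      · rw [injective_iff_map_eq_zero]
        rintro ⟨⟨a, b⟩, h⟩ h0
        have h0' : a = 0 := h0
        subst h0'
        have := hi1 b h
        subst this
        rfl
      · intro X
        obtain ⟨Y, hY⟩ := hs1 X
        exact ⟨⟨_, hY⟩, rfl⟩)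
  let e2 : S ≃ₐ[ℚ] Matrix (Fin m) (Fin m) ℚ := AlgEquiv.ofBijective
    ((AlgHom.snd ℚ _ _).comp S.val) (by
      constructor
      · rw [injective_iff_map_eq_zero]
        rintro ⟨⟨a, b⟩, h⟩ h0
        have h0' : b = 0 := h0
        subst h0'
        have := hi2 a h
        subst this
        rfl
      · intro X
        obtain ⟨Y, hY⟩ := hs2 X
        exact ⟨⟨_, hY⟩, rfl⟩)
  obtain ⟨P, Q, h1, h2, h3⟩ := matrix_aut_inner (e1.symm.trans e2)
  refine ⟨P, Q, h1, h2, fun g hg => ?_⟩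
  rw [← h3]
  have : matQ g = e1 ⟨_, hmem g hg⟩ := rfl
  rw [this, AlgEquiv.trans_apply, AlgEquiv.symm_apply_apply]
  rfl

/-- If `N` is an absolutely irreducible (over `ℚ`) normal subgroup of
`H ≤ SL(m,ℤ)` with `tr(h) = tr(h⁻¹)` for all `h ∈ N`, then `H` lies in a similarity
group over `ℚ`. -/
theorem similarity_of_normal_isometry (m : ℕ) (hm : 2 ≤ m)
    (H N : Subgroup (SL m ℤ)) (hNH : N ≤ H) (hNorm : (N.subgroupOf H).Normal)
    (hNirr : AbsIrredQ N)
    (htr : ∀ h ∈ N, (h : Matrix (Fin m) (Fin m) ℤ).trace =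
      ((h⁻¹ : SL m ℤ) : Matrix (Fin m) (Fin m) ℤ).trace) :
    ∃ Φ : Matrix (Fin m) (Fin m) ℚ, IsUnit Φ ∧
      ∀ h ∈ H, ∃ α : ℚ, matQ h * Φ * (matQ h)ᵀ = α • Φ := by
  obtain ⟨P, Q, hPQ, hQP, hform⟩ := exists_form N hNirr htr
  refine ⟨Q, ⟨⟨Q, P, hQP, hPQ⟩, rfl⟩, fun h hh => ?_⟩
  -- every `n ∈ N` is intertwined
  have key : ∀ n ∈ N, matQ n * Q = Q * (matQ n⁻¹)ᵀ := by
    intro n hn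
    rw [hform n hn, ← mul_assoc, ← mul_assoc, hQP, one_mul]
  have hcomm : ∀ n ∈ N, Commute (matQ n) (matQ h * Q * (matQ h)ᵀ * P) := by
    intro n hn
    have hn' : h⁻¹ * n * h ∈ N := by
      have := hNorm.conj_mem ⟨n, hNH hn⟩ (by simpa [Subgroup.mem_subgroupOf] using hn)
        ⟨h⁻¹, H.inv_mem hh⟩
      simpa [Subgroup.mem_subgroupOf] using this
    have k1 := key _ hn'
    have e1 : matQ n * matQ h = matQ h * matQ (h⁻¹ * n * h) := by
      rw [← matQ_mul, ← matQ_mul]; congr 1; group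
    have e2 : (matQ (h⁻¹ * n * h)⁻¹)ᵀ * (matQ h)ᵀ = (matQ h)ᵀ * (matQ n⁻¹)ᵀ := by
      rw [← Matrix.transpose_mul, ← Matrix.transpose_mul, ← matQ_mul, ← matQ_mul]
      congr 2; group
    have e3 : (matQ n⁻¹)ᵀ * P = P * matQ n := by
      rw [hform n hn, mul_assoc, hQP, mul_one]
    show matQ n * (matQ h * Q * (matQ h)ᵀ * P) = matQ h * Q * (matQ h)ᵀ * P * matQ n
    calc matQ n * (matQ h * Q * (matQ h)ᵀ * P)
        = (matQ n * matQ h) * Q * (matQ h)ᵀ * P := by simp only [mul_assoc]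
      _ = matQ h * (matQ (h⁻¹ * n * h) * Q) * (matQ h)ᵀ * P := by rw [e1]; simp only [mul_assoc]
      _ = matQ h * Q * ((matQ (h⁻¹ * n * h)⁻¹)ᵀ * (matQ h)ᵀ) * P := by
          rw [k1]; simp only [mul_assoc]
      _ = matQ h * Q * (matQ h)ᵀ * ((matQ n⁻¹)ᵀ * P) := by rw [e2]; simp only [mul_assoc]
      _ = _ := by rw [e3]; simp only [mul_assoc]
  have hall : ∀ X, Commute X (matQ h * Q * (matQ h)ᵀ * P) := by
    intro X
    have hX : X ∈ Algebra.adjoin ℚ (matQ '' (N : Set (SL m ℤ))) := by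
      rw [show Algebra.adjoin ℚ (matQ '' (N : Set (SL m ℤ))) = ⊤ from hNirr]; trivial
    induction hX using Algebra.adjoin_induction with
    | mem x h => obtain ⟨g, hg, rfl⟩ := h; exact hcomm g hg
    | algebraMap r => exact Algebra.commutes r _
    | add x y _ _ hx hy => exact hx.add_left hy
    | mul x y _ _ hx hy => exact hx.mul_left hy
  obtain ⟨α, hα⟩ := Matrix.mem_range_scalar_of_commute_single
    (M := matQ h * Q * (matQ h)ᵀ * P) (fun i j _ => hall _)
  refine ⟨α, ?_⟩
  calc matQ h * Q * (matQ h)ᵀ = matQ h * Q * (matQ h)ᵀ * P * Q := by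
        rw [mul_assoc _ P Q, hPQ, mul_one]
    _ = α • Q := by rw [← hα]; simp [Matrix.smul_eq_diagonal_mul]
end
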